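/- Let R be a Cohen-Macaulay local ring of dimension d ≥ 3 and M a maximal Cohen-Macaulay R-module with a free direct summand such that A = End_R(M) is maximal Cohen-Macaulay. If there exists an integer n with 1 ≤ n ≤ d − 2 such that M^{⊥_n} := {X ∈ MCM(R) : Ext_R^i(M,X) = 0 for 1 ≤ i ≤ n} equals add(M), then the global dimension of A is at most d. -/

import Mathlib

universe u

open CategoryTheory Opposite IsLocalRing

def pdLE (A : Type u) [Ring A] : ℕ → ModuleCat.{u} A → Prop
  | 0, N => Module.Projective A N
  | n + 1, N => ∃ (ι : Type u) (f : (ι →₀ A) →ₗ[A] N), Function.Surjective f ∧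
      pdLE A n (ModuleCat.of A (LinearMap.ker f))

noncomputable def globalDimension (A : Type u) [Ring A] : ℕ∞ :=
  sInf {c : ℕ∞ | ∃ n : ℕ, c = (n : ℕ∞) ∧ ∀ N : ModuleCat.{u} A, pdLE A n N}

noncomputable abbrev ExtGroup (R : Type) [CommRing R] (i : ℕ)
    (M N : Type) [AddCommGroup M] [Module R M] [AddCommGroup N] [Module R N] : Type :=
  ((Ext R (ModuleCat R) i).obj (op (ModuleCat.of R M))).obj (ModuleCat.of R N)

noncomputable def moduleDepth (R : Type) [CommRing R] [IsLocalRing R]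
    (M : Type) [AddCommGroup M] [Module R M] : ℕ∞ :=
  sInf {i : ℕ∞ | ∃ n : ℕ, i = n ∧ Nontrivial (ExtGroup R n (ResidueField R) M)}

def IsCohenMacaulayLocalRing (R : Type) [CommRing R] [IsLocalRing R] : Prop :=
  IsNoetherianRing R ∧ ((moduleDepth R R : ℕ∞) : WithBot ℕ∞) = ringKrullDim R

def IsMCM (R : Type) [CommRing R] [IsLocalRing R]
    (M : Type) [AddCommGroup M] [Module R M] : Prop :=
  Module.Finite R M ∧ ((moduleDepth R M : ℕ∞) : WithBot ℕ∞) = ringKrullDim R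

def InAdd (R : Type) [CommRing R] (M X : Type) [AddCommGroup M] [Module R M]
    [AddCommGroup X] [Module R X] : Prop :=
  ∃ (k : ℕ) (s : X →ₗ[R] (Fin k → M)) (r : (Fin k → M) →ₗ[R] X), r ∘ₗ s = LinearMap.id


theorem oldExt_iff (R : Type) [CommRing R] (X Y : ModuleCat.{0} R) (P : ProjectiveResolution X)
    (i : ℕ) : Subsingleton (((Ext R (ModuleCat R) i).obj (op X)).obj Y) ↔
    (P.complex.linearYonedaObj R Y).ExactAt i := by
  rw [HomologicalComplex.exactAt_iff_isZero_homology, ← ModuleCat.isZero_iff_subsingleton]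
  exact (P.isoExt i Y).isZero_iff

theorem ext_iff0 (R : Type) [CommRing R] (X Y : ModuleCat.{0} R) (P : ProjectiveResolution X)
    (i : ℕ) : Subsingleton (((Ext R (ModuleCat R) i).obj (op X)).obj Y) ↔
   Subsingleton (Abelian.Ext X Y i) := by
  rw [oldExt_iff R X Y P]
  rcases i with _ | i
  · rw [HomologicalComplex.exactAt_iff' _ 0 0 1 (by simp) (by simp),
      ShortComplex.moduleCat_exact_iff]
    constructor
    · intro h
      refine subsingleton_of_forall_eq 0 fun a => ?_
      obtain ⟨f, hf, rfl⟩ := P.extMk_surjective a _ rfl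
      obtain ⟨g, hg⟩ := h f hf
      have h0 : (P.complex.linearYonedaObj R Y).d 0 0 = 0 :=
        HomologicalComplex.shape _ _ _ (by simp)
      have hf0 : f = 0 := by
        rw [← hg]
        change ((P.complex.linearYonedaObj R Y).d 0 0) g = 0
        rw [h0]; rfl
      subst hf0
      simp
    · intro h f hf
      have hf' : P.complex.d 1 0 ≫ f = 0 := hf
      have ex := P.exact₀
      have : Epi (ShortComplex.mk _ _ P.complex_d_comp_π_f_zero).g := by
        have : Epi (P.π.f 0) := inferInstance
        exact this
      have h1 := ex.g_desc (k := f) hf'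
      have h2 : ex.desc f hf' = 0 := by
        apply (Abelian.Ext.homEquiv₀ (X := X) (Y := Y)).symm.injective
        exact Subsingleton.elim _ _
      have h3 : f = 0 := by rw [← h1, h2]; exact Limits.comp_zero
      exact ⟨0, by rw [map_zero]; exact h3.symm⟩
  · rw [HomologicalComplex.exactAt_iff' _ i (i+1) (i+1+1) (by simp) (by simp),
      ShortComplex.moduleCat_exact_iff]
    constructor
    · intro h
      refine subsingleton_of_forall_eq 0 fun a => ?_
      obtain ⟨f, hf, rfl⟩ := P.extMk_surjective a _ rfl
      obtain ⟨g, hg⟩ := h f hf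
      exact (P.extMk_eq_zero_iff _ _ _ hf _ rfl).2 ⟨g, hg⟩
    · intro h f hf
      obtain ⟨g, hg⟩ := (P.extMk_eq_zero_iff _ _ rfl hf _ rfl).1 (Subsingleton.elim _ _)
      exact ⟨g, hg⟩

theorem extGroup_iff (R : Type) [CommRing R] (X Y : Type) [AddCommGroup X] [Module R X]
    [AddCommGroup Y] [Module R Y] (i : ℕ) : Subsingleton (ExtGroup R i X Y) ↔
   Subsingleton (Abelian.Ext (ModuleCat.of R X) (ModuleCat.of R Y) i) :=
  ext_iff0 R _ _ (ProjectiveResolution.of _) i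

section ses
variable {R : Type} [Ring R]

/-- The short exact sequence `0 → ker f → X → Y → 0`. -/
theorem ses_ker {X Y : Type} [AddCommGroup X] [Module R X] [AddCommGroup Y] [Module R Y]
    (f : X →ₗ[R] Y) (hf : Function.Surjective f) :
    (ShortComplex.mk (ModuleCat.ofHom (LinearMap.ker f).subtype) (ModuleCat.ofHom f)
      (by ext x; exact x.2)).ShortExact where
  exact := by
    rw [ShortComplex.moduleCat_exact_iff]
    intro x hx
    exact ⟨⟨x, hx⟩, rfl⟩
  mono_f := (ModuleCat.mono_iff_injective _).2 (Submodule.subtype_injective _)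
  epi_g := (ModuleCat.epi_iff_surjective _).2 hf

/-- vanishing of Ext for the kernel -/
theorem ext_ker (Z : ModuleCat.{0} R) {X Y : Type} [AddCommGroup X] [Module R X]
    [AddCommGroup Y] [Module R Y] (f : X →ₗ[R] Y) (hf : Function.Surjective f) (i : ℕ)
    (h1 : Subsingleton (Abelian.Ext Z (ModuleCat.of R X) (i+1)))
    (h2 : Subsingleton (Abelian.Ext Z (ModuleCat.of R Y) i)) :
    Subsingleton (Abelian.Ext Z (ModuleCat.of R (LinearMap.ker f)) (i+1)) := by
  refine subsingleton_of_forall_eq 0 fun a => ?_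
  obtain ⟨x, rfl⟩ := Abelian.Ext.covariant_sequence_exact₁ Z (ses_ker f hf) a
    (h1.elim _ _) rfl
  have : x = 0 := h2.elim _ _
  simp [this]

theorem ext_zero_iff (Z Y : ModuleCat.{0} R) :
    Subsingleton (Abelian.Ext Z Y 0) ↔ ∀ g : Z →ₗ[R] Y, g = 0 := by
  rw [Equiv.subsingleton_congr (Abelian.Ext.homEquiv₀ (X := Z) (Y := Y)),
    Equiv.subsingleton_congr ModuleCat.homEquiv]
  exact ⟨fun h g => Subsingleton.elim _ _, fun h => subsingleton_of_forall_eq 0 h⟩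

theorem ext_zero_of_inj (Z : ModuleCat.{0} R) {X Y : Type} [AddCommGroup X] [Module R X]
    [AddCommGroup Y] [Module R Y] (f : X →ₗ[R] Y) (hf : Function.Injective f)
    (h : Subsingleton (Abelian.Ext Z (ModuleCat.of R Y) 0)) :
    Subsingleton (Abelian.Ext Z (ModuleCat.of R X) 0) := by
  rw [ext_zero_iff] at h ⊢
  intro g
  have := h (f ∘ₗ g)
  ext x
  apply hf
  simpa using DFunLike.congr_fun this x

theorem ext_one_ker (Z : Type) [AddCommGroup Z] [Module R Z] {X Y : Type} [AddCommGroup X]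
    [Module R X]
    [AddCommGroup Y] [Module R Y] (f : X →ₗ[R] Y) (hf : Function.Surjective f)
    (h1 : Subsingleton (Abelian.Ext (ModuleCat.of R Z) (ModuleCat.of R X) 1))
    (h2 : ∀ g : Z →ₗ[R] Y, ∃ g' : Z →ₗ[R] X, f ∘ₗ g' = g) :
    Subsingleton (Abelian.Ext (ModuleCat.of R Z) (ModuleCat.of R (LinearMap.ker f)) 1) := by
  refine subsingleton_of_forall_eq 0 fun a => ?_
  obtain ⟨x, rfl⟩ := Abelian.Ext.covariant_sequence_exact₁ _ (ses_ker f hf) a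
    (h1.elim _ _) (zero_add 1)
  obtain ⟨g, rfl⟩ := Abelian.Ext.homEquiv₀.symm.surjective x
  obtain ⟨g', hg'⟩ := h2 g.hom
  have : g = ModuleCat.ofHom g' ≫ ModuleCat.ofHom f := by
    ext x; simpa using (DFunLike.congr_fun hg' x).symm
  change (Abelian.Ext.mk₀ g).comp _ _ = 0
  rw [this, ← Abelian.Ext.mk₀_comp_mk₀]
  have := (ses_ker f hf).comp_extClass
  dsimp at this
  rw [Abelian.Ext.comp_assoc_of_second_deg_zero, this, Abelian.Ext.comp_zero]

theorem ext_pi (Z Y : ModuleCat.{0} R) (i k : ℕ) (h : Subsingleton (Abelian.Ext Z Y i)) :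
    Subsingleton (Abelian.Ext Z (ModuleCat.of R (Fin k → Y)) i) := by
  refine subsingleton_of_forall_eq 0 fun a => ?_
  have e : 𝟙 (ModuleCat.of R (Fin k → Y)) = ∑ j : Fin k,
      ModuleCat.ofHom (LinearMap.proj j) ≫ ModuleCat.ofHom (LinearMap.single R (fun _ => Y) j) := by
    ext x : 3
    simp [Finset.univ_sum_single]
  rw [← Abelian.Ext.comp_mk₀_id a, e, Abelian.Ext.mk₀_sum, Abelian.Ext.comp_sum]
  refine Finset.sum_eq_zero fun j _ => ?_
  rw [← Abelian.Ext.mk₀_comp_mk₀, ← Abelian.Ext.comp_assoc_of_third_deg_zero]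
  rw [h.elim (a.comp _ _) 0, Abelian.Ext.zero_comp]

theorem ext_retract (Z : ModuleCat.{0} R) {X Y : Type} [AddCommGroup X] [Module R X]
    [AddCommGroup Y] [Module R Y] (s : X →ₗ[R] Y) (r : Y →ₗ[R] X) (hrs : r ∘ₗ s = LinearMap.id)
    (i : ℕ) (h : Subsingleton (Abelian.Ext Z (ModuleCat.of R Y) i)) :
    Subsingleton (Abelian.Ext Z (ModuleCat.of R X) i) := by
  refine subsingleton_of_forall_eq 0 fun a => ?_
  have e : 𝟙 (ModuleCat.of R X) = ModuleCat.ofHom s ≫ ModuleCat.ofHom r := by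
    ext x; simpa using (DFunLike.congr_fun hrs x).symm
  rw [← Abelian.Ext.comp_mk₀_id a, e]
  rw [← Abelian.Ext.mk₀_comp_mk₀, ← Abelian.Ext.comp_assoc_of_third_deg_zero]
  rw [h.elim (a.comp _ _) 0, Abelian.Ext.zero_comp]

theorem ext_prod (Z : ModuleCat.{0} R) {X Y : Type} [AddCommGroup X] [Module R X]
    [AddCommGroup Y] [Module R Y] (i : ℕ) (h : Subsingleton (Abelian.Ext Z (ModuleCat.of R X) i))
    (h' : Subsingleton (Abelian.Ext Z (ModuleCat.of R Y) i)) :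
    Subsingleton (Abelian.Ext Z (ModuleCat.of R (X × Y)) i) := by
  refine subsingleton_of_forall_eq 0 fun a => ?_
  have e : 𝟙 (ModuleCat.of R (X × Y)) =
      ModuleCat.ofHom (LinearMap.fst R X Y) ≫ ModuleCat.ofHom (LinearMap.inl R X Y) +
      ModuleCat.ofHom (LinearMap.snd R X Y) ≫ ModuleCat.ofHom (LinearMap.inr R X Y) := by
    ext x <;> simp
  rw [← Abelian.Ext.comp_mk₀_id a, e, Abelian.Ext.mk₀_add, Abelian.Ext.comp_add]
  rw [← Abelian.Ext.mk₀_comp_mk₀, ← Abelian.Ext.comp_assoc_of_third_deg_zero,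
    ← Abelian.Ext.mk₀_comp_mk₀, ← Abelian.Ext.comp_assoc_of_third_deg_zero]
  rw [h.elim (a.comp _ _) 0, h'.elim (a.comp _ _) 0, Abelian.Ext.zero_comp,
    Abelian.Ext.zero_comp, add_zero]
end ses

section pd
variable {B : Type} [Ring B]

theorem pd_surj {X Y : Type} [AddCommGroup X] [Module B X] [AddCommGroup Y] [Module B Y]
    (f : X →ₗ[B] Y) (hf : Function.Surjective f) (n : ℕ) (hX : Module.Projective B X)
    (h : HasProjectiveDimensionLT (ModuleCat.of B (LinearMap.ker f)) (n+1)) :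
    HasProjectiveDimensionLT (ModuleCat.of B Y) (n+2) := by
  have : Projective (ModuleCat.of B X) := (IsProjective.iff_projective X).1 hX
  exact ((ses_ker f hf).hasProjectiveDimensionLT_X₃_iff n this).2 h

theorem pd_equiv {X Y : Type} [AddCommGroup X] [Module B X] [AddCommGroup Y] [Module B Y]
    (e : X ≃ₗ[B] Y) (n : ℕ)
    (h : HasProjectiveDimensionLT (ModuleCat.of B X) n) :
    HasProjectiveDimensionLT (ModuleCat.of B Y) n :=
  hasProjectiveDimensionLT_of_iso e.toModuleIso n

theorem pd_proj {X : Type} [AddCommGroup X] [Module B X] (hX : Module.Projective B X) (n : ℕ) :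
    HasProjectiveDimensionLT (ModuleCat.of B X) (n + 1) := by
  have : Projective (ModuleCat.of B X) := (IsProjective.iff_projective X).1 hX
  exact hasProjectiveDimensionLT_of_ge _ 1 _ (by omega)
end pd

/-- `Hom_R(M,N)` regarded as a right module over `End_R(M)`. -/
def HomR (R M N : Type) [CommRing R] [AddCommGroup M] [Module R M] [AddCommGroup N]
    [Module R N] : Type := M →ₗ[R] N

namespace HomR
variable {R M : Type} [CommRing R] [AddCommGroup M] [Module R M]
variable {N N' : Type} [AddCommGroup N] [Module R N] [AddCommGroup N'] [Module R N']

instance : AddCommGroup (HomR R M N) := inferInstanceAs (AddCommGroup (M →ₗ[R] N))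

/-- wrap -/
def mk : (M →ₗ[R] N) ≃+ HomR R M N := AddEquiv.refl _

instance : Module (Module.End R M)ᵐᵒᵖ (HomR R M N) where
  smul a f := mk (mk.symm f ∘ₗ a.unop)
  one_smul f := rfl
  mul_smul a b f := rfl
  smul_zero a := rfl
  smul_add a f g := rfl
  add_smul a b f := by
    apply mk.symm.injective
    exact LinearMap.comp_add _ _ _
  zero_smul f := by
    apply mk.symm.injective
    exact LinearMap.comp_zero _

theorem smul_def (a : (Module.End R M)ᵐᵒᵖ) (f : HomR R M N) :
    a • f = mk (mk.symm f ∘ₗ a.unop) := rfl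

/-- functoriality -/
def map (g : N →ₗ[R] N') : HomR R M N →ₗ[(Module.End R M)ᵐᵒᵖ] HomR R M N' where
  toFun f := mk (g ∘ₗ mk.symm f)
  map_add' a b := by
    apply mk.symm.injective
    exact LinearMap.comp_add _ _ _
  map_smul' a f := rfl

theorem map_mk (g : N →ₗ[R] N') (f : M →ₗ[R] N) : map g (mk f) = mk (g ∘ₗ f) := rfl

/-- `Hom(M, M^k)` is free. -/
def piEquiv (k : ℕ) : HomR R M (Fin k → M) ≃ₗ[(Module.End R M)ᵐᵒᵖ]
    (Fin k → (Module.End R M)ᵐᵒᵖ) where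
  toFun h j := MulOpposite.op (LinearMap.proj j ∘ₗ mk.symm h)
  invFun h := mk (LinearMap.pi fun j => (h j).unop)
  map_add' a b := rfl
  map_smul' a b := rfl
  left_inv h := rfl
  right_inv h := rfl

theorem proj_pi (k : ℕ) : Module.Projective (Module.End R M)ᵐᵒᵖ (HomR R M (Fin k → M)) :=
  Module.Projective.of_equiv (piEquiv k).symm

theorem proj_inAdd (h : InAdd R M N) : Module.Projective (Module.End R M)ᵐᵒᵖ (HomR R M N) := by
  obtain ⟨k, s, r, hrs⟩ := h
  have := proj_pi (R := R) (M := M) k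
  refine Module.Projective.of_split (map s) (map r) ?_
  ext f
  change mk ((r ∘ₗ s) ∘ₗ mk.symm f) = _
  rw [hrs]; rfl

/-- kernels -/
def kerEquiv (g : N →ₗ[R] N') : HomR R M (LinearMap.ker g) ≃ₗ[(Module.End R M)ᵐᵒᵖ]
    LinearMap.ker (map (M := M) g) where
  toFun f := ⟨map (LinearMap.ker g).subtype f, by
    apply mk.symm.injective
    ext x
    exact ((mk.symm f) x).2⟩
  invFun f := mk (LinearMap.codRestrict _ (mk.symm f.1) fun x => by
    have := f.2
    rw [LinearMap.mem_ker] at this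
    exact DFunLike.congr_fun (congrArg mk.symm this) x)
  map_add' a b := by ext1; exact map_add _ _ _
  map_smul' a b := rfl
  left_inv h := rfl
  right_inv h := rfl

theorem cover [IsNoetherianRing R] [Module.Finite R M] [Module.Finite R N]
    (S : Submodule (Module.End R M)ᵐᵒᵖ (HomR R M N)) :
    ∃ (k : ℕ) (g : (Fin k → M) →ₗ[R] N), LinearMap.range (map (M := M) g) = S := by
  let S' : Submodule R (M →ₗ[R] N) :=
    { carrier := {f | mk f ∈ S}
      add_mem' := fun {a b} ha hb => S.add_mem ha hb
      zero_mem' := S.zero_mem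
      smul_mem' := fun r f hf => by
        have : mk (r • f) = MulOpposite.op (r • LinearMap.id : Module.End R M) • mk f := by
          apply mk.symm.injective
          ext x
          exact (map_smul f r x).symm
        change mk (r • f) ∈ S
        rw [this]
        exact S.smul_mem _ hf }
  have : IsNoetherian R (M →ₗ[R] N) := inferInstance
  obtain ⟨k, gens, hg⟩ := Submodule.fg_iff_exists_fin_generating_family.1 (this.noetherian S')
  let g : (Fin k → M) →ₗ[R] N := ∑ j, gens j ∘ₗ LinearMap.proj j
  refine ⟨k, g, le_antisymm ?_ ?_⟩
  · rintro _ ⟨h, rfl⟩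
    have : map g h = ∑ j, MulOpposite.op (LinearMap.proj j ∘ₗ mk.symm h) • mk (gens j) := by
      apply mk.symm.injective
      rw [map_sum]
      ext x
      rw [LinearMap.sum_apply]
      change g (mk.symm h x) = _
      simp only [g, LinearMap.sum_apply]
      rfl
    rw [this]
    refine S.sum_mem fun j _ => S.smul_mem _ ?_
    have : gens j ∈ S' := hg ▸ Submodule.subset_span ⟨j, rfl⟩
    exact this
  · intro x hx
    have hx' : mk.symm x ∈ Submodule.span R (Set.range gens) := by
      rw [hg]; exact hx
    have : ∀ y ∈ Submodule.span R (Set.range gens), mk y ∈ LinearMap.range (map (M := M) g) := by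
      intro y hy
      induction hy using Submodule.span_induction with
      | mem y hy =>
        obtain ⟨j, rfl⟩ := hy
        refine ⟨mk (LinearMap.single R (fun _ => M) j), ?_⟩
        apply mk.symm.injective
        ext x
        change g (Pi.single j x) = gens j x
        simp only [g, LinearMap.sum_apply, LinearMap.comp_apply, LinearMap.proj_apply]
        rw [Finset.sum_eq_single j]
        · simp
        · intro b _ hb; simp [hb]
        · simp
      | zero => exact Submodule.zero_mem _
      | add a b _ _ ha hb => exact Submodule.add_mem _ ha hb
      | smul r a _ ha =>
        obtain ⟨z, hz⟩ := ha
        refine ⟨mk (r • mk.symm z), ?_⟩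
        apply mk.symm.injective
        ext x
        have := DFunLike.congr_fun (congrArg mk.symm hz) x
        change g (mk.symm z x) = a x at this
        change g (r • mk.symm z x) = r • a x
        rw [map_smul, this]
    exact this _ hx'

end HomR

section main
variable {R M : Type} [CommRing R] [AddCommGroup M] [Module R M]

open HomR in
theorem pd_chain [IsNoetherianRing R] [Module.Finite R M] (K : ModuleCat.{0} R) (d n : ℕ)
    (hn : n ≤ d - 2) (hd : 3 ≤ d)
    (p : M →ₗ[R] R) (m₀ : M) (hp : p m₀ = 1)
    (hk : ∀ i < d, Subsingleton (Abelian.Ext K (ModuleCat.of R M) i))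
    (hMM : ∀ i, 1 ≤ i → i ≤ n →
      Subsingleton (Abelian.Ext (ModuleCat.of R M) (ModuleCat.of R M) i))
    (hadd : ∀ (X : Type) [AddCommGroup X] [Module R X], Module.Finite R X →
      (∀ i < d, Subsingleton (Abelian.Ext K (ModuleCat.of R X) i)) →
      (∀ i, 1 ≤ i → i ≤ n → Subsingleton (Abelian.Ext (ModuleCat.of R M) (ModuleCat.of R X) i)) →
      InAdd R M X) (e : ℕ) :
    ∀ (j : ℕ) (N : Type) [AddCommGroup N] [Module R N], j + e = d - 2 → Module.Finite R N →
      (∀ i < j + 2, Subsingleton (Abelian.Ext K (ModuleCat.of R N) i)) →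
      (∀ i, 1 ≤ i → i ≤ n → i ≤ j →
        Subsingleton (Abelian.Ext (ModuleCat.of R M) (ModuleCat.of R N) i)) →
      HasProjectiveDimensionLT (ModuleCat.of (Module.End R M)ᵐᵒᵖ (HomR R M N)) (e + 1) := by
  induction e with
  | zero =>
    intro j N _ _ hj hfin h1 h2
    apply pd_proj
    apply proj_inAdd
    refine hadd N hfin (fun i hi => h1 i (by omega)) (fun i hi hi' => h2 i hi hi' (by omega))
  | succ e ih =>
    intro j N _ _ hj hfin h1 h2
    obtain ⟨k, g, hg⟩ := cover (R := R) (M := M) (N := N) ⊤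
    have hlift : ∀ u : M →ₗ[R] N, ∃ u' : M →ₗ[R] (Fin k → M), g ∘ₗ u' = u := by
      intro u
      have : mk u ∈ LinearMap.range (map (M := M) g) := by rw [hg]; trivial
      obtain ⟨v, hv⟩ := this
      exact ⟨mk.symm v, hv⟩
    have hsurj : Function.Surjective g := by
      intro y
      obtain ⟨u, hu⟩ := hlift (p.smulRight y)
      refine ⟨u m₀, ?_⟩
      have := DFunLike.congr_fun hu m₀
      simpa [hp] using this
    refine pd_surj (map g) (LinearMap.range_eq_top.1 hg) e (proj_pi k) ?_
    refine pd_equiv (kerEquiv g) _ ?_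
    refine ih (j + 1) _ (by omega) inferInstance ?_ ?_
    · intro i hi
      rcases i with _ | i
      · exact ext_zero_of_inj K (LinearMap.ker g).subtype (Submodule.subtype_injective _)
          (ext_pi K (ModuleCat.of R M) 0 k (hk 0 (by omega)))
      · exact ext_ker K g hsurj i (ext_pi K (ModuleCat.of R M) _ k (hk _ (by omega)))
          (h1 i (by omega))
    · intro i hi hin hij
      rcases i with _ | _ | i
      · omega
      · exact ext_one_ker M g hsurj
          (ext_pi (ModuleCat.of R M) (ModuleCat.of R M) _ k (hMM _ (by omega) (by omega))) hlift
      · exact ext_ker (ModuleCat.of R M) g hsurj (i+1)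
          (ext_pi (ModuleCat.of R M) (ModuleCat.of R M) _ k (hMM _ (by omega) (by omega)))
          (h2 (i+1) (by omega) (by omega) (by omega))

open HomR in
theorem pd_right [IsNoetherianRing R] [Module.Finite R M] (K : ModuleCat.{0} R) (d n : ℕ)
    (hn : n ≤ d - 2) (hd : 3 ≤ d)
    (p : M →ₗ[R] R) (m₀ : M) (hp : p m₀ = 1)
    (hk : ∀ i < d, Subsingleton (Abelian.Ext K (ModuleCat.of R M) i))
    (hMM : ∀ i, 1 ≤ i → i ≤ n →
      Subsingleton (Abelian.Ext (ModuleCat.of R M) (ModuleCat.of R M) i))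
    (hadd : ∀ (X : Type) [AddCommGroup X] [Module R X], Module.Finite R X →
      (∀ i < d, Subsingleton (Abelian.Ext K (ModuleCat.of R X) i)) →
      (∀ i, 1 ≤ i → i ≤ n → Subsingleton (Abelian.Ext (ModuleCat.of R M) (ModuleCat.of R X) i)) →
      InAdd R M X)
    (X : Type) [AddCommGroup X] [Module (Module.End R M)ᵐᵒᵖ X]
    [Module.Finite (Module.End R M)ᵐᵒᵖ X] :
    HasProjectiveDimensionLT (ModuleCat.of (Module.End R M)ᵐᵒᵖ X) (d + 1) := by
  obtain ⟨c, rfl⟩ : ∃ c, d = c + 2 := ⟨d - 2, by omega⟩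
  obtain ⟨k0, q, hq⟩ := Module.Finite.exists_fin' (Module.End R M)ᵐᵒᵖ X
  let q' := q ∘ₗ (piEquiv (R := R) (M := M) k0).toLinearMap
  have hq' : Function.Surjective q' := hq.comp (piEquiv k0).surjective
  refine pd_surj q' hq' (c + 1) (proj_pi k0) ?_
  obtain ⟨k1, g, hg⟩ := cover (R := R) (M := M) (LinearMap.ker q')
  rw [← hg]
  refine pd_surj (map g).rangeRestrict (LinearMap.surjective_rangeRestrict _) c (proj_pi k1) ?_
  rw [LinearMap.ker_rangeRestrict]
  refine pd_equiv (kerEquiv g) _ ?_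
  refine pd_chain K (c + 2) n hn hd p m₀ hp hk hMM hadd c 0 _ (by omega) inferInstance ?_
    (fun i _ _ _ => by omega)
  intro i hi
  have hr : Subsingleton (Abelian.Ext K (ModuleCat.of R (LinearMap.range g)) 0) :=
    ext_zero_of_inj K (LinearMap.range g).subtype (Submodule.subtype_injective _)
          (ext_pi K (ModuleCat.of R M) 0 k0 (hk 0 (by omega)))
  rcases i with _ | _ | i
  · exact ext_zero_of_inj K (LinearMap.ker g).subtype (Submodule.subtype_injective _)
          (ext_pi K (ModuleCat.of R M) 0 k1 (hk 0 (by omega)))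
  · have := ext_ker K g.rangeRestrict (LinearMap.surjective_rangeRestrict _) 0
      (ext_pi K (ModuleCat.of R M) _ k1 (hk _ (by omega))) hr
    rw [LinearMap.ker_rangeRestrict] at this
    exact this
  · omega
end main

section dual
variable {A : Type} [Ring A]

theorem ses_quot {G : Type} [AddCommGroup G] [Module A G] (S : Submodule A G) :
    (ShortComplex.mk (ModuleCat.ofHom S.subtype) (ModuleCat.ofHom S.mkQ)
      (by ext x; simp)).ShortExact where
  exact := by
    rw [ShortComplex.moduleCat_exact_iff]
    intro x hx
    exact ⟨⟨x, (Submodule.Quotient.mk_eq_zero S).1 hx⟩, rfl⟩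
  mono_f := (ModuleCat.mono_iff_injective _).2 (Submodule.subtype_injective _)
  epi_g := (ModuleCat.epi_iff_surjective _).2 (Submodule.mkQ_surjective _)

theorem extend_of_ext {G : Type} [AddCommGroup G] [Module A G] (S : Submodule A G)
    (N : Type) [AddCommGroup N] [Module A N]
    (h : Subsingleton (Abelian.Ext (ModuleCat.of A (G ⧸ S)) (ModuleCat.of A N) 1))
    (g : S →ₗ[A] N) : ∃ g' : G →ₗ[A] N, ∀ x : S, g' x = g x := by
  obtain ⟨y, hy⟩ := Abelian.Ext.contravariant_sequence_exact₁ (ses_quot S) (ModuleCat.of A N)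
    (Abelian.Ext.mk₀ (ModuleCat.ofHom g)) (add_zero 1) (h.elim _ _)
  obtain ⟨g', rfl⟩ := Abelian.Ext.homEquiv₀.symm.surjective y
  refine ⟨g'.hom, fun x => ?_⟩
  change (Abelian.Ext.mk₀ _).comp (Abelian.Ext.mk₀ g') _ = _ at hy
  rw [Abelian.Ext.mk₀_comp_mk₀] at hy
  have := Abelian.Ext.homEquiv₀.symm.injective hy
  exact DFunLike.congr_fun (congrArg ModuleCat.Hom.hom this) x

/-- dimension shifting -/
theorem ext_shift (D : ModuleCat.{0} A) {S : ShortComplex (ModuleCat.{0} A)} (hS : S.ShortExact)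
    (hI : Injective S.X₂) (j : ℕ) (h : Subsingleton (Abelian.Ext D S.X₁ (j + 2))) :
    Subsingleton (Abelian.Ext D S.X₃ (j + 1)) := by
  refine subsingleton_of_forall_eq 0 fun a => ?_
  obtain ⟨x, rfl⟩ := Abelian.Ext.covariant_sequence_exact₃ D hS a rfl (h.elim _ _)
  rw [Abelian.Ext.eq_zero_of_injective x, Abelian.Ext.zero_comp]

/-- Auslander's argument, injective version. -/
theorem injDim_of_finite (e : ℕ) : ∀ N : ModuleCat.{0} A,
    (∀ (Y : Type) [AddCommGroup Y] [Module A Y], Module.Finite A Y →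
      Subsingleton (Abelian.Ext (ModuleCat.of A Y) N (e + 1))) →
    HasInjectiveDimensionLT N (e + 1) := by
  induction e with
  | zero =>
    intro N h
    have hb : Module.Baer A N := by
      intro I g
      obtain ⟨g', hg'⟩ := extend_of_ext (A := A) (G := A) I N (h _ inferInstance) g
      exact ⟨g', fun x hx => hg' ⟨x, hx⟩⟩
    have : Module.Injective A N := hb.injective
    have : Injective N := Module.injective_object_of_injective_module A N
    infer_instance
  | succ e ih =>
    intro N h
    obtain ⟨p⟩ := EnoughInjectives.presentation N
    have hS : (ShortComplex.mk _ _ (Limits.cokernel.condition p.f)).ShortExact :=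
      { exact := ShortComplex.exact_cokernel p.f }
    refine hS.hasInjectiveDimensionLT_X₁ (e + 1) ?_ ?_
    · refine ih _ fun Y _ _ hY => ?_
      exact ext_shift _ hS p.injective e (h Y hY)
    · have : Injective p.J := p.injective
      exact hasInjectiveDimensionLT_of_ge p.J 1 _ (by omega)

theorem auslander (d : ℕ) (h : ∀ (Y : Type) [AddCommGroup Y] [Module A Y], Module.Finite A Y →
      HasProjectiveDimensionLT (ModuleCat.of A Y) (d + 1)) (N : ModuleCat.{0} A) :
    HasProjectiveDimensionLT N (d + 1) := by
  rw [hasProjectiveDimensionLT_iff]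
  intro i hi Y a
  have : HasInjectiveDimensionLT Y (d + 1) := by
    refine injDim_of_finite d Y fun Z _ _ hZ => ?_
    have := h Z hZ
    exact HasProjectiveDimensionLT.subsingleton _ (d + 1) _ le_rfl _
  exact a.eq_zero_of_hasInjectiveDimensionLT (d + 1) hi

theorem pdLE_of (n : ℕ) : ∀ N : ModuleCat.{0} A, HasProjectiveDimensionLT N (n + 1) →
    pdLE A n N := by
  induction n with
  | zero =>
    intro N h
    have : Projective N := (projective_iff_hasProjectiveDimensionLT_one).2 h
    exact (IsProjective.iff_projective N).2 this
  | succ n ih =>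
    intro N h
    have hs : Function.Surjective (Finsupp.linearCombination A (id : N → N)) :=
      Finsupp.linearCombination_id_surjective A N
    refine ⟨N, Finsupp.linearCombination A (id : N → N), hs, ih _ ?_⟩
    have : Projective (ModuleCat.of A (N →₀ A)) := (IsProjective.iff_projective _).1 inferInstance
    exact ((ses_ker _ hs).hasProjectiveDimensionLT_X₃_iff n this).1 h

/-- The character module of a left module, as a right module. -/
def Ch (W : Type) [AddCommGroup W] : Type := W →+ AddCircle (1 : ℚ)

namespace Ch
variable {W W' : Type} [AddCommGroup W] [Module A W] [AddCommGroup W'] [Module A W']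

noncomputable instance : AddCommGroup (Ch W) :=
  inferInstanceAs (AddCommGroup (W →+ AddCircle (1 : ℚ)))

/-- wrap -/
noncomputable def mk : (W →+ AddCircle (1 : ℚ)) ≃+ Ch W := AddEquiv.refl _

noncomputable instance : Module Aᵐᵒᵖ (Ch W) where
  smul a f := mk ((mk.symm f).comp (DistribSMul.toAddMonoidHom W a.unop))
  one_smul f := by
    apply mk.symm.injective; ext x
    exact congrArg (mk.symm f) (one_smul A x)
  mul_smul a b f := by
    apply mk.symm.injective; ext x
    exact congrArg (mk.symm f) (mul_smul b.unop a.unop x)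
  smul_zero a := rfl
  smul_add a f g := rfl
  add_smul a b f := by
    apply mk.symm.injective; ext x
    exact (congrArg (mk.symm f) (add_smul a.unop b.unop x)).trans (map_add _ _ _)
  zero_smul f := by
    apply mk.symm.injective; ext x
    exact (congrArg (mk.symm f) (zero_smul A x)).trans (map_zero _)

theorem smul_apply (a : Aᵐᵒᵖ) (f : Ch W) (x : W) : mk.symm (a • f) x = mk.symm f (a.unop • x) :=
  rfl

/-- functoriality -/
noncomputable def map (f : W →ₗ[A] W') : Ch W' →ₗ[Aᵐᵒᵖ] Ch W where
  toFun c := mk ((mk.symm c).comp f.toAddMonoidHom)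
  map_add' a b := rfl
  map_smul' a c := by
    apply mk.symm.injective; ext x
    exact congrArg (mk.symm c) (map_smul f a.unop x).symm

theorem map_apply (f : W →ₗ[A] W') (c : Ch W') (x : W) :
    mk.symm (map f c) x = mk.symm c (f x) := rfl

theorem extend {X Y : Type} [AddCommGroup X] [AddCommGroup Y] (f : X →+ Y)
    (hf : Function.Injective f) (g : X →+ AddCircle (1 : ℚ)) :
    ∃ h : Y →+ AddCircle (1 : ℚ), ∀ x, h (f x) = g x := by
  obtain ⟨h, hh⟩ := (Module.Baer.of_divisible (AddCircle (1 : ℚ))).extension_property_addMonoidHom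
    f hf g
  exact ⟨h, fun x => DFunLike.congr_fun hh x⟩

theorem injective_free (k : ℕ) :
    Injective (ModuleCat.of Aᵐᵒᵖ (Ch (Fin k → A))) := by
  have : Module.Injective Aᵐᵒᵖ (Ch (Fin k → A)) := by
    refine ⟨fun X Y _ _ _ _ f hf g => ?_⟩
    let φ : (Fin k → X) →+ AddCircle (1 : ℚ) :=
      { toFun := fun x => ∑ j, mk.symm (g (x j)) (Pi.single j 1)
        map_zero' := by simp
        map_add' := fun x y => by simp [Finset.sum_add_distrib] }
    obtain ⟨ψ, hψ⟩ := extend (f.toAddMonoidHom.compLeft (Fin k))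
      (fun x y hxy => funext fun j => hf (congrFun hxy j)) φ
    let h : Y →ₗ[Aᵐᵒᵖ] Ch (Fin k → A) :=
      { toFun := fun y => mk
          { toFun := fun a => ψ fun j => MulOpposite.op (a j) • y
            map_zero' := by
              have : (fun j : Fin k => MulOpposite.op ((0 : Fin k → A) j) • y) = 0 := by
                ext j; simp
              rw [this, map_zero]
            map_add' := fun a b => by
              rw [← map_add]; congr 1; ext j; simp [add_smul] }
        map_add' := fun y z => by
          apply mk.symm.injective; refine AddMonoidHom.ext fun a => ?_
          change ψ _ = ψ _ + ψ _
          rw [← map_add]; congr 1; ext j; simp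
        map_smul' := fun b y => by
          apply mk.symm.injective; refine AddMonoidHom.ext fun a => ?_
          change ψ _ = ψ _
          congr 1; ext j; simp [smul_smul, MulOpposite.op_mul] }
    refine ⟨h, fun x => ?_⟩
    apply mk.symm.injective; refine AddMonoidHom.ext fun a => ?_
    change ψ (fun j => MulOpposite.op (a j) • f x) = _
    have h1 : (fun j => MulOpposite.op (a j) • f x) =
        (f.toAddMonoidHom.compLeft (Fin k)) (fun j => MulOpposite.op (a j) • x) := by
      ext j; simp
    rw [h1, hψ]
    change ∑ j, mk.symm (g (MulOpposite.op (a j) • x)) (Pi.single j 1) = _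
    simp only [map_smul, smul_apply, MulOpposite.unop_op]
    rw [← map_sum]
    congr 1
    ext j
    simp [Finset.sum_apply, Pi.single_apply]
  exact Module.injective_object_of_injective_module _ _

theorem ses (f : W →ₗ[A] W') (hf : Function.Surjective f) :
    (ShortComplex.mk (ModuleCat.ofHom (map f)) (ModuleCat.ofHom (map (LinearMap.ker f).subtype))
      (by
        ext c : 2
        apply mk.symm.injective; ext x
        exact (congrArg (mk.symm c) x.2).trans (map_zero _))).ShortExact where
  exact := by
    rw [ShortComplex.moduleCat_exact_iff]
    intro c hc
    have hc' : ∀ x, f x = 0 → mk.symm c x = 0 := fun x hx =>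
      DFunLike.congr_fun (congrArg mk.symm hc) (⟨x, hx⟩ : LinearMap.ker f)
    refine ⟨mk (f.toAddMonoidHom.liftOfRightInverse (Function.surjInv hf)
      (Function.rightInverse_surjInv hf) ⟨mk.symm c, fun x hx => hc' x hx⟩), ?_⟩
    apply mk.symm.injective; ext x
    exact AddMonoidHom.liftOfRightInverse_comp_apply f.toAddMonoidHom _
      (Function.rightInverse_surjInv hf) ⟨mk.symm c, fun x hx => hc' x hx⟩ x
  mono_f := (ModuleCat.mono_iff_injective _).2 (by
    intro a b hab
    apply mk.symm.injective; ext y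
    obtain ⟨x, rfl⟩ := hf y
    exact DFunLike.congr_fun (congrArg mk.symm hab) x)
  epi_g := (ModuleCat.epi_iff_surjective _).2 (by
    intro c
    obtain ⟨h, hh⟩ := extend (LinearMap.ker f).subtype.toAddMonoidHom
      (Submodule.subtype_injective _) (mk.symm c)
    refine ⟨mk h, ?_⟩
    apply mk.symm.injective; ext x
    exact hh x)
end Ch

theorem base_lemma {K : Type} [AddCommGroup K] [Module A K] {n m : ℕ}
    (q : (Fin n → A) →ₗ[A] K) (hq : Function.Surjective q)
    (x : Fin m → (Fin n → A)) (hx : LinearMap.ker q = Submodule.span A (Set.range x))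
    (h : ∀ (D : Type) [AddCommGroup D] [Module Aᵐᵒᵖ D], Module.Finite Aᵐᵒᵖ D →
      Subsingleton (Abelian.Ext (ModuleCat.of Aᵐᵒᵖ D) (ModuleCat.of Aᵐᵒᵖ (Ch K)) 1)) :
    Module.Projective A K := by
  have hqx : ∀ i, q (x i) = 0 := fun i => by
    have : x i ∈ LinearMap.ker q := hx ▸ Submodule.subset_span ⟨i, rfl⟩
    exact this
  let c : Fin n → (Fin m → Aᵐᵒᵖ) := fun j i => MulOpposite.op (x i j)
  let S : Submodule Aᵐᵒᵖ (Fin m → Aᵐᵒᵖ) := Submodule.span _ (Set.range c)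
  let C : Fin n → S := fun j => ⟨c j, Submodule.subset_span ⟨j, rfl⟩⟩
  let Φ : (Fin m → S) →+ (Fin n → S) :=
    { toFun := fun w j => ∑ i, MulOpposite.op (x i j) • w i
      map_zero' := by ext j; simp
      map_add' := fun a b => by
        refine funext fun j => ?_
        simp only [Pi.add_apply, smul_add, Finset.sum_add_distrib] }
  have key : C ∈ Φ.range := by
    by_contra hC
    have hne : (QuotientAddGroup.mk C : (Fin n → S) ⧸ Φ.range) ≠ 0 := fun h0 =>
      hC ((QuotientAddGroup.eq_zero_iff C).1 h0)
    obtain ⟨χ', hχ'⟩ := CharacterModule.exists_character_apply_ne_zero_of_ne_zero hne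
    let χ : (Fin n → S) →+ AddCircle (1 : ℚ) :=
      AddMonoidHom.comp χ' (QuotientAddGroup.mk' Φ.range)
    have hχC : χ C ≠ 0 := hχ'
    have hχΦ : ∀ w, χ (Φ w) = 0 := fun w => by
      have : (QuotientAddGroup.mk (Φ w) : (Fin n → S) ⧸ Φ.range) = 0 :=
        (QuotientAddGroup.eq_zero_iff _).2 ⟨w, rfl⟩
      exact (congrArg χ' this).trans (map_zero χ')
    let γ : S → (Fin n → A) →+ AddCircle (1 : ℚ) := fun w =>
      { toFun := fun a => χ fun j => MulOpposite.op (a j) • w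
        map_zero' := by
          have : (fun j : Fin n => MulOpposite.op ((0 : Fin n → A) j) • w) = 0 := by
            refine funext fun j => ?_
            simp
          rw [this, map_zero]
        map_add' := fun a b => by
          rw [← map_add]; congr 1; refine funext fun j => ?_; simp [add_smul] }
    have hγ : ∀ w a, γ w a = χ fun j => MulOpposite.op (a j) • w := fun _ _ => rfl
    have hγadd : ∀ w w' a, γ (w + w') a = γ w a + γ w' a := fun w w' a => by
      rw [hγ, hγ, hγ, ← map_add]; congr 1; refine funext fun j => ?_; simp
    have hγsmul : ∀ (b : A) w a, γ (MulOpposite.op b • w) a = γ w (b • a) := fun b w a => by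
      rw [hγ, hγ]; congr 1; refine funext fun j => ?_
      simp [smul_smul, MulOpposite.op_mul]
    have hγker : ∀ a, q a = 0 → ∀ w, γ w a = 0 := by
      intro a ha
      have ha' : a ∈ Submodule.span A (Set.range x) := hx ▸ ha
      clear ha
      induction ha' using Submodule.span_induction with
      | mem a ha =>
        obtain ⟨i, rfl⟩ := ha
        intro w
        rw [← hχΦ (Pi.single i w), hγ]
        congr 1
        refine funext fun j => ?_
        change _ = ∑ i', MulOpposite.op (x i' j) • (Pi.single i w : Fin m → S) i'
        rw [Finset.sum_eq_single i]
        · simp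
        · intro b _ hb; simp [Pi.single_eq_of_ne hb]
        · simp
      | zero => intro w; exact map_zero _
      | add a b ha hb iha ihb =>
        intro w
        rw [map_add, iha,
          ihb, add_zero]
      | smul b a ha iha =>
        intro w
        rw [← hγsmul, iha]
    let γ' : S → K →+ AddCircle (1 : ℚ) := fun w =>
      q.toAddMonoidHom.liftOfRightInverse (Function.surjInv hq)
        (Function.rightInverse_surjInv hq) ⟨γ w, fun a ha => hγker a ha w⟩
    have hγ' : ∀ w a, γ' w (q a) = γ w a := fun w a =>
      AddMonoidHom.liftOfRightInverse_comp_apply q.toAddMonoidHom _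
        (Function.rightInverse_surjInv hq) ⟨γ w, fun a ha => hγker a ha w⟩ a
    let g : S →ₗ[Aᵐᵒᵖ] Ch K :=
      { toFun := fun w => Ch.mk (γ' w)
        map_add' := fun w w' => by
          apply Ch.mk.symm.injective
          refine AddMonoidHom.ext fun k => ?_
          obtain ⟨a, rfl⟩ := hq k
          change γ' _ _ = γ' _ _ + γ' _ _
          rw [hγ', hγ', hγ', hγadd]
        map_smul' := fun b w => by
          apply Ch.mk.symm.injective
          refine AddMonoidHom.ext fun k => ?_
          obtain ⟨a, rfl⟩ := hq k
          change γ' _ _ = γ' w (b.unop • q a)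
          rw [← map_smul, hγ', hγ', ← hγsmul, MulOpposite.op_unop] }
    obtain ⟨g', hg'⟩ := extend_of_ext S (Ch K) (h _ inferInstance) g
    apply hχC
    have h1 : C = ∑ j, (fun l => MulOpposite.op ((Pi.single j 1 : Fin n → A) l) • C j) := by
      refine funext fun l => ?_
      rw [Finset.sum_apply, Finset.sum_eq_single l]
      · simp
      · intro b _ hb; simp [Pi.single_eq_of_ne hb.symm]
      · simp
    have h2 : ∀ j, χ (fun l => MulOpposite.op ((Pi.single j 1 : Fin n → A) l) • C j) =
        ∑ i, Ch.mk.symm (g' (Pi.single i 1)) (x i j • q (Pi.single j 1)) := fun j => by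
      rw [← hγ, ← hγ']
      change Ch.mk.symm (g (C j)) _ = _
      rw [← hg']
      have : ((C j : S) : Fin m → Aᵐᵒᵖ) = ∑ i, MulOpposite.op (x i j) • (Pi.single i 1 : Fin m → Aᵐᵒᵖ) := by
        refine funext fun l => ?_
        rw [Finset.sum_apply, Finset.sum_eq_single l]
        · simp [C, c]
        · intro b _ hb; simp [Pi.single_eq_of_ne hb.symm]
        · simp
      rw [this, map_sum, map_sum, AddMonoidHom.finset_sum_apply]
      refine Finset.sum_congr rfl fun i _ => ?_
      rw [map_smul, Ch.smul_apply, MulOpposite.unop_op]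
    rw [h1, map_sum, Finset.sum_congr rfl fun j _ => h2 j, Finset.sum_comm]
    refine Finset.sum_eq_zero fun i _ => ?_
    rw [← map_sum]
    have : ∑ j, x i j • q (Pi.single j 1) = q (x i) := by
      rw [← Finset.sum_congr rfl fun j _ => map_smul q (x i j) _, ← map_sum]
      congr 1
      refine funext fun l => ?_
      rw [Finset.sum_apply, Finset.sum_eq_single l]
      · simp
      · intro b _ hb; simp [Pi.single_eq_of_ne hb.symm]
      · simp
    rw [this, hqx, map_zero]
  obtain ⟨w, hw⟩ := key
  have hβ : ∀ i, ∃ β : Fin n → Aᵐᵒᵖ, ∑ l, β l • c l = (w i : Fin m → Aᵐᵒᵖ) := fun i =>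
    (Submodule.mem_span_range_iff_exists_fun Aᵐᵒᵖ).1 (w i).2
  choose β hβ using hβ
  have hrel : ∀ i' j, x i' j = ∑ l, x i' l * ∑ i, MulOpposite.unop (β i l) * x i j := by
    intro i' j
    have h1 := congrArg (fun s : S => MulOpposite.unop ((s : Fin m → Aᵐᵒᵖ) i')) (congrFun hw j)
    have h2 : MulOpposite.unop ((C j : Fin m → Aᵐᵒᵖ) i') = x i' j := rfl
    change MulOpposite.unop (((∑ i, MulOpposite.op (x i j) • w i : S) : Fin m → Aᵐᵒᵖ) i') = MulOpposite.unop ((C j : Fin m → Aᵐᵒᵖ) i') at h1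
    rw [h2] at h1
    rw [← h1]
    simp only [Submodule.coe_sum, Submodule.coe_smul, ← hβ, Finset.sum_apply, Pi.smul_apply,
      smul_eq_mul, Finset.unop_sum, MulOpposite.unop_mul, MulOpposite.unop_op, Finset.mul_sum, Finset.sum_mul, c]
    rw [Finset.sum_comm]
    refine Finset.sum_congr rfl fun l _ => Finset.sum_congr rfl fun i _ => ?_
    rw [mul_assoc]
  let P : (Fin n → A) →ₗ[A] (Fin n → A) :=
    { toFun := fun a => ∑ l, a l • ∑ i, MulOpposite.unop (β i l) • x i
      map_add' := fun a b => by simp [add_smul, Finset.sum_add_distrib]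
      map_smul' := fun b a => by simp [mul_smul, Finset.smul_sum] }
  have hP : ∀ a, P a = ∑ l, a l • ∑ i, MulOpposite.unop (β i l) • x i := fun _ => rfl
  have hqP : ∀ a, q (P a) = 0 := fun a => by
    rw [hP]; simp [map_sum, hqx]
  have hPx : ∀ i, P (x i) = x i := fun i' => by
    refine funext fun j => ?_
    rw [hP, hrel i' j]
    simp [Finset.sum_apply]
  have hPker : LinearMap.ker q ≤ LinearMap.ker (LinearMap.id - P) := by
    rw [hx, Submodule.span_le]
    rintro _ ⟨i, rfl⟩
    simp [hPx]
  let s : K →ₗ[A] (Fin n → A) :=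
    ((LinearMap.ker q).liftQ (LinearMap.id - P) hPker) ∘ₗ
      (q.quotKerEquivOfSurjective hq).symm.toLinearMap
  have hs : ∀ a, s (q a) = a - P a := fun a => by
    have : (q.quotKerEquivOfSurjective hq).symm (q a) = Submodule.Quotient.mk a := by
      rw [LinearEquiv.symm_apply_eq]; rfl
    simp only [s, LinearMap.comp_apply, LinearEquiv.coe_coe]
    rw [this]; rfl
  refine Module.Projective.of_split s q (LinearMap.ext fun k => ?_)
  obtain ⟨a, rfl⟩ := hq k
  rw [LinearMap.comp_apply, hs, map_sub, hqP, sub_zero]; rfl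

theorem left_pd [IsNoetherianRing A] (j : ℕ) : ∀ (W : Type) [AddCommGroup W] [Module A W],
    Module.Finite A W →
    (∀ (D : Type) [AddCommGroup D] [Module Aᵐᵒᵖ D], Module.Finite Aᵐᵒᵖ D →
      Subsingleton (Abelian.Ext (ModuleCat.of Aᵐᵒᵖ D) (ModuleCat.of Aᵐᵒᵖ (Ch W)) (j + 1))) →
    HasProjectiveDimensionLT (ModuleCat.of A W) (j + 1) := by
  induction j with
  | zero =>
    intro W _ _ hW h
    obtain ⟨k, q, hq⟩ := Module.Finite.exists_fin' A W
    have hfg : (LinearMap.ker q).FG := IsNoetherian.noetherian _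
    obtain ⟨m, x, hx⟩ := Submodule.fg_iff_exists_fin_generating_family.1 hfg
    have := base_lemma q hq x hx.symm h
    exact (projective_iff_hasProjectiveDimensionLT_one).1
      ((IsProjective.iff_projective (ModuleCat.of A W)).1 this)
  | succ j ih =>
    intro W _ _ hW h
    obtain ⟨k, q, hq⟩ := Module.Finite.exists_fin' A W
    have : Projective (ModuleCat.of A (Fin k → A)) := (IsProjective.iff_projective _).1 inferInstance
    refine ((ses_ker _ hq).hasProjectiveDimensionLT_X₃_iff j this).2 ?_
    refine ih _ inferInstance fun D _ _ hD => ?_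
    exact ext_shift _ (Ch.ses q hq) (Ch.injective_free k) j (h D hD)
end dual

theorem depth_iff (R : Type) [CommRing R] [IsLocalRing R] (X : Type) [AddCommGroup X] [Module R X]
    (d : ℕ) : moduleDepth R X = d ↔
      (∀ i < d, Subsingleton (Abelian.Ext (ModuleCat.of R (ResidueField R)) (ModuleCat.of R X) i)) ∧
      ¬ Subsingleton (Abelian.Ext (ModuleCat.of R (ResidueField R)) (ModuleCat.of R X) d) := by
  simp only [← extGroup_iff]
  unfold moduleDepth
  constructor
  · intro h
    refine ⟨fun i hi => ?_, ?_⟩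
    · by_contra hc
      have hnt := not_subsingleton_iff_nontrivial.1 hc
      have : sInf {i : ℕ∞ | ∃ n : ℕ, i = n ∧ Nontrivial (ExtGroup R n (ResidueField R) X)} ≤ i :=
        sInf_le ⟨i, rfl, hnt⟩
      rw [h] at this
      have := ENat.coe_le_coe.1 this
      omega
    · have hne : {i : ℕ∞ | ∃ n : ℕ, i = n ∧
          Nontrivial (ExtGroup R n (ResidueField R) X)}.Nonempty := by
        by_contra hc
        rw [Set.not_nonempty_iff_eq_empty] at hc
        rw [hc, sInf_empty] at h
        exact ENat.top_ne_coe d h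
      obtain ⟨n, hn, hnt⟩ := csInf_mem hne
      rw [h] at hn
      have : d = n := ENat.coe_inj.1 hn
      subst this
      exact not_subsingleton_iff_nontrivial.2 hnt
  · rintro ⟨h1, h2⟩
    refine le_antisymm (sInf_le ⟨d, rfl, not_subsingleton_iff_nontrivial.1 h2⟩) ?_
    refine le_sInf ?_
    rintro _ ⟨n, rfl, hn⟩
    rw [ENat.coe_le_coe]
    by_contra hc
    exact not_subsingleton_iff_nontrivial.2 hn (h1 n (by omega))

/-- Let `R` be a Cohen-Macaulay local ring of dimension `d ≥ 3` and `M` a maximal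
Cohen-Macaulay module with a free summand such that `A = End_R(M)` is maximal
Cohen-Macaulay.  If for some `1 ≤ n ≤ d − 2` the subcategory
`M^{⊥_n} = {X ∈ MCM : Ext^i(M,X) = 0, 1 ≤ i ≤ n}` equals `add M`, then
`gl.dim A ≤ d`. -/
theorem globalDimension_le_of_perp_eq_add
    (R : Type) [CommRing R] [IsLocalRing R] (hCM : IsCohenMacaulayLocalRing R)
    (d : ℕ) (hd : 3 ≤ d) (hdim : ringKrullDim R = d)
    (M : Type) [AddCommGroup M] [Module R M] (hM : IsMCM R M)
    (hfree : ∃ N : Submodule R M, Nonempty (M ≃ₗ[R] R × N))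
    (hA : IsMCM R (M →ₗ[R] M))
    (n : ℕ) (hn1 : 1 ≤ n) (hn2 : n ≤ d - 2)
    (hperp : ∀ (X : Type) [AddCommGroup X] [Module R X], IsMCM R X →
      ((∀ i : ℕ, 1 ≤ i → i ≤ n → Subsingleton (ExtGroup R i M X)) ↔ InAdd R M X)) :
    globalDimension (Module.End R M) ≤ (d : ℕ∞) := by
  have hNoeth : IsNoetherianRing R := hCM.1
  have hMfin : Module.Finite R M := hM.1
  have hMCM : ∀ (X : Type) [AddCommGroup X] [Module R X],
      IsMCM R X ↔ Module.Finite R X ∧ moduleDepth R X = d := by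
    intro X _ _
    unfold IsMCM
    rw [hdim]
    have : ((d : ℕ) : WithBot ℕ∞) = ((d : ℕ∞) : WithBot ℕ∞) := rfl
    rw [this, WithBot.coe_inj]
  have hMd := (depth_iff R M d).1 ((hMCM M).1 hM).2
  obtain ⟨N, ⟨e⟩⟩ := hfree
  have hMM : InAdd R M M :=
    ⟨1, LinearMap.pi fun _ => LinearMap.id, LinearMap.proj 0, by ext x; simp⟩
  have hadd : ∀ (X : Type) [AddCommGroup X] [Module R X], Module.Finite R X →
      (∀ i < d, Subsingleton (Abelian.Ext (ModuleCat.of R (ResidueField R)) (ModuleCat.of R X) i)) →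
      (∀ i, 1 ≤ i → i ≤ n → Subsingleton (Abelian.Ext (ModuleCat.of R M) (ModuleCat.of R X) i)) →
      InAdd R M X := by
    intro X _ _ hX h1 h2
    have hXM : IsMCM R (X × M) := by
      rw [hMCM]
      refine ⟨inferInstance, (depth_iff R _ d).2 ⟨fun i hi => ?_, fun hs => hMd.2 ?_⟩⟩
      · exact ext_prod _ i (h1 i hi) (hMd.1 i hi)
      · exact ext_retract _ (LinearMap.inr R X M) (LinearMap.snd R X M) (by ext x; simp) d hs
    obtain ⟨k, s, r, hrs⟩ := (hperp (X × M) hXM).1 fun i hi hi' =>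
      (extGroup_iff R M (X × M) i).2 (ext_prod _ i (h2 i hi hi')
        ((extGroup_iff R M M i).1 ((hperp M hM).2 hMM i hi hi')))
    refine ⟨k, s ∘ₗ LinearMap.inl R X M, LinearMap.fst R X M ∘ₗ r, LinearMap.ext fun x => ?_⟩
    have := DFunLike.congr_fun hrs (x, (0 : M))
    simp only [LinearMap.comp_apply, LinearMap.inl_apply, LinearMap.id_apply] at this ⊢
    rw [this]; rfl
  have hright : ∀ (D : Type) [AddCommGroup D] [Module (Module.End R M)ᵐᵒᵖ D],
      Module.Finite (Module.End R M)ᵐᵒᵖ D →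
      HasProjectiveDimensionLT (ModuleCat.of (Module.End R M)ᵐᵒᵖ D) (d + 1) := by
    intro D _ _ hD
    exact pd_right (ModuleCat.of R (ResidueField R)) d n hn2 hd
      (LinearMap.fst R R N ∘ₗ e.toLinearMap) (e.symm (1, 0)) (by simp) hMd.1
      (fun i hi hi' => (extGroup_iff R M M i).1 ((hperp M hM).2 hMM i hi hi'))
      hadd D
  have hEnd : IsNoetherianRing (Module.End R M) := isNoetherian_of_tower R inferInstance
  have hleft : ∀ (W : Type) [AddCommGroup W] [Module (Module.End R M) W],
      Module.Finite (Module.End R M) W →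
      HasProjectiveDimensionLT (ModuleCat.of (Module.End R M) W) (d + 1) := by
    intro W _ _ hW
    refine left_pd d W hW fun D _ _ hD => ?_
    have := hright D hD
    exact HasProjectiveDimensionLT.subsingleton _ (d + 1) _ le_rfl _
  exact sInf_le ⟨d, rfl, fun N => pdLE_of d N (auslander d hleft N)⟩
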